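/- arXiv:2510.27017 — 3 statements merged into one kernel-verified Lean document; each statement's English description precedes it below -/
import Mathlib

section
/- Let the vocabulary be V = {1, …, n}, let P be a probability distribution on V, let ℓ : V → ℝ≥0 be a loss that is strictly increasing in the index (v < w implies ℓ(v) < ℓ(w)), and let b > 0. Define the dual function L(μ) = min_{d∈{0,1}^n} [ Σ_{v=1}^{n} P_v ℓ(v)(1 − d_v) + μ(Σ_{v=1}^{n} P_v d_v − b) ]. If k̂ satisfies the critical condition Σ_{v=k̂+1}^{n} P_v ≤ b < Σ_{v=k̂}^{n} P_v, then μ̂ = ℓ(k̂) maximizes L over μ ≥ 0: for every μ ≥ 0, L(μ) ≤ L(ℓ(k̂)). -/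
open Finset

/-- The risk `r(d) = ∑_{v=1}^n P_v ℓ(v) (1 - d_v)`. -/
noncomputable def risk (n : ℕ) (P ℓ d : ℕ → ℝ) : ℝ :=
  ∑ v ∈ Icc 1 n, P v * ℓ v * (1 - d v)

/-- The Lagrangian `L(d, μ) = r(d) + μ (∑_{v=1}^n P_v d_v - b)`. -/
noncomputable def lagrangian (n : ℕ) (P ℓ : ℕ → ℝ) (b : ℝ) (d : ℕ → ℝ) (μ : ℝ) : ℝ :=
  risk n P ℓ d + μ * ((∑ v ∈ Icc 1 n, P v * d v) - b)

/-- The dual function `L(μ) = min_{d ∈ {0,1}^n} L(d, μ)`. -/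
noncomputable def dualFn (n : ℕ) (P ℓ : ℕ → ℝ) (b μ : ℝ) : ℝ :=
  sInf {x : ℝ | ∃ d : ℕ → ℝ, (∀ v ∈ Icc 1 n, d v = 0 ∨ d v = 1) ∧
    x = lagrangian n P ℓ b d μ}

/-- if `k̂` satisfies the critical condition
`∑_{v=k̂+1}^n P_v ≤ b < ∑_{v=k̂}^n P_v`, then `μ̂ = ℓ(k̂)` maximizes the dual
function `L(μ)` over `μ ≥ 0`. -/
theorem critical_multiplier_maximizes_dual
    (n : ℕ) (P ℓ : ℕ → ℝ)
    (hP0 : ∀ v ∈ Icc 1 n, 0 ≤ P v) (hP1 : ∑ v ∈ Icc 1 n, P v = 1)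
    (hℓ0 : ∀ v ∈ Icc 1 n, 0 ≤ ℓ v)
    (hℓmono : ∀ v ∈ Icc 1 n, ∀ w ∈ Icc 1 n, v < w → ℓ v < ℓ w)
    (b : ℝ) (hb : 0 < b)
    (khat : ℕ) (hk : khat ∈ Icc 1 n)
    (hcrit₁ : (∑ v ∈ Icc (khat + 1) n, P v) ≤ b)
    (hcrit₂ : b < ∑ v ∈ Icc khat n, P v) :
    ∀ μ : ℝ, 0 ≤ μ → dualFn n P ℓ b μ ≤ dualFn n P ℓ b (ℓ khat) := by
  intro μ hμ
  have hk' := Finset.mem_Icc.mp hk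
  -- termwise form of the Lagrangian
  have hform : ∀ (d : ℕ → ℝ) (m : ℝ), lagrangian n P ℓ b d m =
      (∑ v ∈ Icc 1 n, P v * (ℓ v * (1 - d v) + m * d v)) - m * b := by
    intro d m
    unfold lagrangian risk
    rw [mul_sub, Finset.mul_sum, ← add_sub_assoc, ← Finset.sum_add_distrib]
    congr 1
    exact Finset.sum_congr rfl fun v _ => by ring
  have hbdd : BddBelow {x : ℝ | ∃ d : ℕ → ℝ, (∀ v ∈ Icc 1 n, d v = 0 ∨ d v = 1) ∧
      x = lagrangian n P ℓ b d μ} := by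
    refine ⟨-(μ * b), ?_⟩
    rintro x ⟨d, hd, rfl⟩
    rw [hform]
    have : 0 ≤ ∑ v ∈ Icc 1 n, P v * (ℓ v * (1 - d v) + μ * d v) := by
      refine Finset.sum_nonneg fun v hv => mul_nonneg (hP0 v hv) ?_
      rcases hd v hv with h | h <;> rw [h]
      · simpa using hℓ0 v hv
      · simpa using hμ
    linarith
  -- threshold rules
  have hsum : ∀ j : ℕ, 1 ≤ j →
      ∑ v ∈ Icc 1 n, P v * (if j ≤ v then (1 : ℝ) else 0) = ∑ v ∈ Icc j n, P v := by
    intro j hj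
    simp only [mul_ite, mul_one, mul_zero]
    rw [← Finset.sum_filter]
    refine Finset.sum_congr ?_ fun _ _ => rfl
    ext v
    simp only [Finset.mem_filter, Finset.mem_Icc]
    omega
  have key : ∀ j : ℕ, (j = khat ∨ j = khat + 1) →
      (μ - ℓ khat) * ((∑ v ∈ Icc j n, P v) - b) ≤ 0 →
      dualFn n P ℓ b μ ≤ dualFn n P ℓ b (ℓ khat) := by
    intro j hj hle
    unfold dualFn
    refine le_csInf ⟨_, fun _ => 0, fun _ _ => Or.inl rfl, rfl⟩ ?_
    rintro x ⟨d, hd, rfl⟩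
    refine (csInf_le hbdd ⟨fun v => if j ≤ v then (1 : ℝ) else 0, ?_, rfl⟩).trans ?_
    · intro v _
      by_cases h : j ≤ v <;> simp [h]
    have h1 : lagrangian n P ℓ b (fun v => if j ≤ v then (1 : ℝ) else 0) μ =
        lagrangian n P ℓ b (fun v => if j ≤ v then (1 : ℝ) else 0) (ℓ khat) +
        (μ - ℓ khat) * ((∑ v ∈ Icc j n, P v) - b) := by
      unfold lagrangian
      rw [hsum j (by omega)]
      ring
    have h2 : lagrangian n P ℓ b (fun v => if j ≤ v then (1 : ℝ) else 0) (ℓ khat) ≤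
        lagrangian n P ℓ b d (ℓ khat) := by
      rw [hform, hform]
      refine sub_le_sub_right (Finset.sum_le_sum fun v hv =>
        mul_le_mul_of_nonneg_left ?_ (hP0 v hv)) _
      have hlt : v < khat → ℓ v < ℓ khat := hℓmono v hv khat hk
      have hgt : khat < v → ℓ khat < ℓ v := hℓmono khat hk v hv
      by_cases h : j ≤ v
      · have : ℓ khat ≤ ℓ v := by
          rcases (show khat ≤ v by omega).eq_or_lt with e | e
          · rw [e]
          · exact (hgt e).le
        rcases hd v hv with e | e <;> simp [h, e, this]
      · have : ℓ v ≤ ℓ khat := by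
          rcases (show v ≤ khat by omega).eq_or_lt with e | e
          · rw [e]
          · exact (hlt e).le
        rcases hd v hv with e | e <;> simp [h, e, this]
    linarith
  rcases le_total μ (ℓ khat) with h | h
  · exact key khat (Or.inl rfl)
      (mul_nonpos_of_nonpos_of_nonneg (by linarith) (by linarith))
  · exact key (khat + 1) (Or.inr rfl)
      (mul_nonpos_of_nonneg_of_nonpos (by linarith) (by linarith))
end

section
/- Let p and P be probability distributions on a finite vocabulary V, let b > 0, and let ℓ₁ and ℓ₂ be two order-inverting losses with respect to p (for all v, w: p_v < p_w ⇔ ℓᵢ(w) < ℓᵢ(v), i = 1, 2). Assume additionally that each ℓᵢ is injective on V, so that sorting V in increasing ℓᵢ order is well defined. Then ℓ₁ and ℓ₂ produce the same critical element k̂ (the element determined by the condition Σ_{v : ℓᵢ(v) > ℓᵢ(k̂)} P_v ≤ b < Σ_{v : ℓᵢ(v) ≥ ℓᵢ(k̂)} P_v) and the same primal deferral decision d̂⁺, where d̂⁺_v = ⟦ℓᵢ(v) > ℓᵢ(k̂)⟧; the same statement holds for the plugin versions k̃ and d̃⁺ obtained by replacing P with p. -/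
open Finset

/-- The critical-element condition for a loss `ℓ`, distribution `Q` and budget `b`:
`k` is the element such that `∑_{v : ℓ(v) > ℓ(k)} Q_v ≤ b < ∑_{v : ℓ(v) ≥ ℓ(k)} Q_v`. -/
def IsCritical {V : Type*} [Fintype V] (ℓ Q : V → ℝ) (b : ℝ) (k : V) : Prop :=
  (∑ v ∈ Finset.univ.filter (fun v => ℓ k < ℓ v), Q v) ≤ b ∧
    b < ∑ v ∈ Finset.univ.filter (fun v => ℓ k ≤ ℓ v), Q v

theorem critical_aux {V : Type*} [Fintype V] (Q : V → ℝ) (hQ : ∀ v, 0 ≤ Q v) (b : ℝ)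
    (l₁ l₂ : V → ℝ) (h : ∀ v w : V, l₁ w < l₁ v ↔ l₂ w < l₂ v)
    (hinj : Function.Injective l₁) (k₁ k₂ : V)
    (c₁ : IsCritical l₁ Q b k₁) (c₂ : IsCritical l₂ Q b k₂) :
    k₁ = k₂ ∧ ∀ v : V,
        (if l₁ k₁ < l₁ v then (1 : ℝ) else 0) = (if l₂ k₂ < l₂ v then 1 else 0) := by
  have hk : k₁ = k₂ := by
    obtain ⟨a₁, a₂⟩ := c₁
    obtain ⟨d₁, d₂⟩ := c₂
    rcases lt_trichotomy (l₁ k₁) (l₁ k₂) with hlt | heq | hlt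
    · have : (∑ v ∈ Finset.univ.filter (fun v => l₂ k₂ ≤ l₂ v), Q v)
          ≤ ∑ v ∈ Finset.univ.filter (fun v => l₁ k₁ < l₁ v), Q v := by
        apply Finset.sum_le_sum_of_subset_of_nonneg
        · intro v hv
          simp only [Finset.mem_filter, Finset.mem_univ, true_and] at hv ⊢
          rw [h] at hlt ⊢
          exact lt_of_lt_of_le hlt hv
        · intro v _ _
          exact hQ v
      linarith
    · exact hinj heq
    · have : (∑ v ∈ Finset.univ.filter (fun v => l₁ k₁ ≤ l₁ v), Q v)
          ≤ ∑ v ∈ Finset.univ.filter (fun v => l₂ k₂ < l₂ v), Q v := by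
        apply Finset.sum_le_sum_of_subset_of_nonneg
        · intro v hv
          simp only [Finset.mem_filter, Finset.mem_univ, true_and] at hv ⊢
          rw [← h]
          exact lt_of_lt_of_le hlt hv
        · intro v _ _
          exact hQ v
      linarith
  subst hk
  exact ⟨rfl, fun v => by simp only [h]⟩

/-- two injective, order-inverting losses (w.r.t. `p`) produce the
same critical element and the same primal deferral decision, both for the true
distribution `P` and for the plugin distribution `p`. -/
theorem order_inverting_losses_same_primal_decision
    {V : Type*} [Fintype V]
    (p P : V → ℝ)
    (hp0 : ∀ v, 0 ≤ p v) (hp1 : ∑ v, p v = 1)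
    (hP0 : ∀ v, 0 ≤ P v) (hP1 : ∑ v, P v = 1)
    (b : ℝ) (hb : 0 < b)
    (ℓ₁ ℓ₂ : V → ℝ)
    (h₁ : ∀ v w : V, p v < p w ↔ ℓ₁ w < ℓ₁ v)
    (h₂ : ∀ v w : V, p v < p w ↔ ℓ₂ w < ℓ₂ v)
    (hinj₁ : Function.Injective ℓ₁) (hinj₂ : Function.Injective ℓ₂) :
    (∀ k₁ k₂ : V, IsCritical ℓ₁ P b k₁ → IsCritical ℓ₂ P b k₂ →
      k₁ = k₂ ∧ ∀ v : V,
        (if ℓ₁ k₁ < ℓ₁ v then (1 : ℝ) else 0) = (if ℓ₂ k₂ < ℓ₂ v then 1 else 0)) ∧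
    (∀ k₁ k₂ : V, IsCritical ℓ₁ p b k₁ → IsCritical ℓ₂ p b k₂ →
      k₁ = k₂ ∧ ∀ v : V,
        (if ℓ₁ k₁ < ℓ₁ v then (1 : ℝ) else 0) = (if ℓ₂ k₂ < ℓ₂ v then 1 else 0)) := by
  have h : ∀ v w : V, ℓ₁ w < ℓ₁ v ↔ ℓ₂ w < ℓ₂ v := fun v w => (h₁ v w).symm.trans (h₂ v w)
  exact ⟨fun k₁ k₂ => critical_aux P hP0 b ℓ₁ ℓ₂ h hinj₁ k₁ k₂,
    fun k₁ k₂ => critical_aux p hp0 b ℓ₁ ℓ₂ h hinj₁ k₁ k₂⟩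
end

section
/- Let the vocabulary be V = {1, …, n}, let P be a probability distribution on V, let ℓ : V → ℝ≥0 be a loss that is strictly increasing in the index, let b > 0, and let k̂ satisfy Σ_{v=k̂+1}^{n} P_v ≤ b < Σ_{v=k̂}^{n} P_v. Let d̂⁺_v = ⟦ℓ(v) > ℓ(k̂)⟧ and let d̂ be any minimizer of the risk r(d) = Σ_v P_v ℓ(v)(1 − d_v) over all d ∈ {0,1}^n with Σ_v P_v d_v ≤ b. Then r(d̂⁺) − r(d̂) ≤ ℓ(k̂) · P_{k̂}. -/
open Finset

/-- the risk of the primal approximation `d̂⁺_v = ⟦ℓ(v) > ℓ(k̂)⟧`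
exceeds the optimal constrained risk `r(d̂)` by at most `ℓ(k̂) · P_k̂`. -/
theorem primal_approximation_regret_bound
    (n : ℕ) (P ℓ : ℕ → ℝ)
    (hP0 : ∀ v ∈ Icc 1 n, 0 ≤ P v) (hP1 : ∑ v ∈ Icc 1 n, P v = 1)
    (hℓ0 : ∀ v ∈ Icc 1 n, 0 ≤ ℓ v)
    (hℓmono : ∀ v ∈ Icc 1 n, ∀ w ∈ Icc 1 n, v < w → ℓ v < ℓ w)
    (b : ℝ) (hb : 0 < b)
    (khat : ℕ) (hk : khat ∈ Icc 1 n)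
    (hcrit₁ : (∑ v ∈ Icc (khat + 1) n, P v) ≤ b)
    (hcrit₂ : b < ∑ v ∈ Icc khat n, P v)
    (dhat : ℕ → ℝ)
    (hdhat01 : ∀ v ∈ Icc 1 n, dhat v = 0 ∨ dhat v = 1)
    (hdhatFeas : (∑ v ∈ Icc 1 n, P v * dhat v) ≤ b)
    (hdhatOpt : ∀ d : ℕ → ℝ, (∀ v ∈ Icc 1 n, d v = 0 ∨ d v = 1) →
      (∑ v ∈ Icc 1 n, P v * d v) ≤ b → risk n P ℓ dhat ≤ risk n P ℓ d) :
    risk n P ℓ (fun v => if ℓ khat < ℓ v then 1 else 0) - risk n P ℓ dhat ≤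
      ℓ khat * P khat := by
  obtain ⟨hk1, hkn⟩ := Finset.mem_Icc.mp hk
  have hplus : ∑ v ∈ Icc 1 n, P v * (if ℓ khat < ℓ v then (1:ℝ) else 0)
      = ∑ v ∈ Icc (khat + 1) n, P v := by
    simp only [mul_ite, mul_one, mul_zero]
    rw [← Finset.sum_filter]
    apply Finset.sum_congr _ (fun _ _ => rfl)
    ext v
    simp only [Finset.mem_filter, Finset.mem_Icc]
    constructor
    · rintro ⟨⟨h1, h2⟩, h3⟩
      refine ⟨?_, h2⟩
      by_contra hlt
      rcases Nat.lt_or_ge v khat with h | h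
      · exact absurd (hℓmono v (Finset.mem_Icc.mpr ⟨h1, h2⟩) khat hk h) (not_lt.mpr h3.le)
      · have : v = khat := by omega
        subst this
        exact lt_irrefl _ h3
    · rintro ⟨h1, h2⟩
      exact ⟨⟨by omega, h2⟩,
        hℓmono khat hk v (Finset.mem_Icc.mpr ⟨by omega, h2⟩) (by omega)⟩
  have hsplit : ∑ v ∈ Icc khat n, P v = P khat + ∑ v ∈ Icc (khat + 1) n, P v := by
    rw [← Finset.insert_Icc_add_one_left_eq_Icc hkn, Finset.sum_insert (by simp)]
  have hmain : risk n P ℓ (fun v => if ℓ khat < ℓ v then 1 else 0) - risk n P ℓ dhat ≤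
      ℓ khat * (∑ v ∈ Icc 1 n, P v * dhat v
        - ∑ v ∈ Icc 1 n, P v * (if ℓ khat < ℓ v then (1:ℝ) else 0)) := by
    unfold risk
    rw [← Finset.sum_sub_distrib, ← Finset.sum_sub_distrib, Finset.mul_sum]
    apply Finset.sum_le_sum
    intro v hv
    have hp := hP0 v hv
    beta_reduce
    split_ifs with h
    · rcases hdhat01 v hv with hd | hd <;> rw [hd] <;> nlinarith
    · rcases hdhat01 v hv with hd | hd <;> rw [hd] <;> nlinarith
  refine hmain.trans (mul_le_mul_of_nonneg_left ?_ (hℓ0 khat hk))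
  rw [hplus]
  linarith
end
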